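/- arXiv:2602.11848 — 2 statements merged into one kernel-verified Lean document; each statement's English description precedes it below -/
import Mathlib

section
/- NAND and NOR are the only singly functionally complete binary Boolean operations: for op : Bool → Bool → Bool, the following are equivalent: (i) for every f : Bool → Bool → Bool and every set S of functions Bool → Bool → Bool containing the projections and closed under pointwise application of op (i.e. (fun a b => op (g a b) (h a b)) ∈ S whenever g, h ∈ S), f belongs to S; (ii) op = (fun a b => !(a && b)) or op = (fun a b => !(a || b)). -/
theorem complete_of_not_and (S : Set (Bool → Bool → Bool))
    (ha : (fun a _ => a) ∈ S) (hb : (fun _ b => b) ∈ S)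
    (hn : ∀ g, g ∈ S → (fun a b => !(g a b)) ∈ S)
    (hc : ∀ g h, g ∈ S → h ∈ S → (fun a b => g a b && h a b) ∈ S)
    (f : Bool → Bool → Bool) : f ∈ S := by
  have hd : ∀ g h, g ∈ S → h ∈ S → (fun a b => g a b || h a b) ∈ S := by
    intro g h hg hh
    have := hn _ (hc _ _ (hn _ hg) (hn _ hh))
    simpa using this
  have hk : ∀ c : Bool, (fun _ _ => c) ∈ S := by
    have h0 : (fun _ _ => false) ∈ S := by
      have := hc _ _ ha (hn _ ha)
      simpa using this
    intro c
    cases c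
    · exact h0
    · exact hn _ h0
  have key := hd _ _
    (hd _ _ (hc _ _ (hk (f true true)) (hc _ _ ha hb))
      (hc _ _ (hk (f true false)) (hc _ _ ha (hn _ hb))))
    (hd _ _ (hc _ _ (hk (f false true)) (hc _ _ (hn _ ha) hb))
      (hc _ _ (hk (f false false)) (hc _ _ (hn _ ha) (hn _ hb))))
  convert key using 1
  funext a b
  cases a <;> cases b <;> simp

/-- NAND and NOR are the only singly functionally complete binary Boolean
operations. -/
theorem sheffer_peirce_unique (op : Bool → Bool → Bool) :
    (∀ (f : Bool → Bool → Bool) (S : Set (Bool → Bool → Bool)),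
      (fun a _ => a) ∈ S → (fun _ b => b) ∈ S →
      (∀ g h, g ∈ S → h ∈ S → (fun a b => op (g a b) (h a b)) ∈ S) →
      f ∈ S) ↔
    (op = (fun a b => !(a && b)) ∨ op = (fun a b => !(a || b))) := by
  constructor
  · intro H
    have h1 : op true true = false := by
      by_contra hne
      have ht : op true true = true := by simpa using hne
      have := H (fun _ _ => false) {g | g true true = true} rfl rfl
        (fun g h hg hh => by
          simp only [Set.mem_setOf_eq] at *
          rw [hg, hh, ht])
      simp at this
    have h2 : op false false = true := by
      by_contra hne
      have ht : op false false = false := by simpa using hne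
      have := H (fun _ _ => true) {g | g false false = false} rfl rfl
        (fun g h hg hh => by
          simp only [Set.mem_setOf_eq] at *
          rw [hg, hh, ht])
      simp at this
    have h3 : op true false = op false true := by
      by_contra hne
      have hs : ∀ x y, op (!x) (!y) = !(op x y) := by
        intro x y
        cases x <;> cases y <;> simp [h1, h2] <;>
          cases h : op true false <;> cases h' : op false true <;> simp_all
      have := H (fun _ _ => true) {g | ∀ a b, g (!a) (!b) = !(g a b)}
        (fun _ _ => rfl) (fun _ _ => rfl)
        (fun g h hg hh a b => by
          simp only [Set.mem_setOf_eq] at hg hh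
          simp only [hg, hh, hs])
      simp at this
    cases h : op false true
    · right
      funext a b
      cases a <;> cases b <;> simp_all
    · left
      funext a b
      cases a <;> cases b <;> simp_all
  · rintro (rfl | rfl) f S ha hb hop
    · have hn : ∀ g, g ∈ S → (fun a b => !(g a b)) ∈ S := fun g hg => by
        simpa using hop g g hg hg
      refine complete_of_not_and S ha hb hn (fun g h hg hh => ?_) f
      simpa only [Bool.not_not] using hn _ (hop g h hg hh)
    · have hn : ∀ g, g ∈ S → (fun a b => !(g a b)) ∈ S := fun g hg => by
        simpa using hop g g hg hg
      refine complete_of_not_and S ha hb hn (fun g h hg hh => ?_) f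
      simpa using hop _ _ (hn g hg) (hn h hh)
end

section
/- Any binary Boolean operation whose truth table contains exactly one, or exactly three, true values, together with negation, is functionally complete: if op : Bool → Bool → Bool satisfies that the number of pairs (a, b) ∈ Bool × Bool with op a b = true is 1 or 3, then for every f : Bool → Bool → Bool and every set S of functions Bool → Bool → Bool containing the projections, closed under pointwise application of op (i.e. (fun a b => op (g a b) (h a b)) ∈ S whenever g, h ∈ S), and closed under pointwise negation (i.e. (fun a b => !(g a b)) ∈ S whenever g ∈ S), f belongs to S. -/
/-- Conjunction is `op` up to negating inputs and output. -/
theorem and_from_op (op : Bool → Bool → Bool)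
    (hcard : (Finset.univ.filter (fun x : Bool × Bool => op x.1 x.2 = true)).card = 1 ∨
             (Finset.univ.filter (fun x : Bool × Bool => op x.1 x.2 = true)).card = 3) :
    ∃ p q s : Bool, ∀ a b, (a && b) = xor s (op (xor p a) (xor q b)) := by
  have e : (Finset.univ : Finset (Bool × Bool)) =
    {(true, true), (true, false), (false, true), (false, false)} := by decide
  rw [e] at hcard
  simp only [Finset.filter_insert, Finset.filter_singleton] at hcard
  simp only [Bool.exists_bool, Bool.forall_bool]
  cases h1 : op true true <;> cases h2 : op true false <;> cases h3 : op false true <;>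
    cases h4 : op false false <;> simp_all

/-- Any binary Boolean operation whose truth table has exactly one or exactly
three true values, together with negation, is functionally complete. -/
theorem three_one_with_negation_complete (op : Bool → Bool → Bool)
    (hcard : (Finset.univ.filter (fun x : Bool × Bool => op x.1 x.2 = true)).card = 1 ∨
             (Finset.univ.filter (fun x : Bool × Bool => op x.1 x.2 = true)).card = 3)
    (f : Bool → Bool → Bool) (S : Set (Bool → Bool → Bool))
    (hp : (fun a _ => a) ∈ S) (hq : (fun _ b => b) ∈ S)
    (hop : ∀ g h, g ∈ S → h ∈ S → (fun a b => op (g a b) (h a b)) ∈ S)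
    (hnot : ∀ g, g ∈ S → (fun a b => !(g a b)) ∈ S) :
    f ∈ S := by
  obtain ⟨p, q, s, hpqs⟩ := and_from_op op hcard
  have hx : ∀ (c : Bool) g, g ∈ S → (fun a b => xor c (g a b)) ∈ S := by
    intro c g hg
    cases c
    · simpa using hg
    · simpa using hnot g hg
  have hand : ∀ g h, g ∈ S → h ∈ S → (fun a b => g a b && h a b) ∈ S := by
    intro g h hg hh
    have := hx s _ (hop _ _ (hx p g hg) (hx q h hh))
    simpa only [← hpqs] using this
  have hor : ∀ g h, g ∈ S → h ∈ S → (fun a b => g a b || h a b) ∈ S := by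
    intro g h hg hh
    have := hnot _ (hand _ _ (hnot g hg) (hnot h hh))
    simpa using this
  have hfalse : (fun _ _ => false) ∈ S := by
    have := hand _ _ hp (hnot _ hp)
    simpa using this
  have hc : ∀ c : Bool, (fun _ _ => c) ∈ S := by
    intro c
    simpa using hx c _ hfalse
  have hm : ∀ u v : Bool, (fun a b => (xor u a && xor v b) && f (!u) (!v)) ∈ S :=
    fun u v => hand _ _ (hand _ _ (hx u _ hp) (hx v _ hq)) (hc _)
  have key := hor _ _ (hor _ _ (hm true true) (hm true false))
    (hor _ _ (hm false true) (hm false false))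
  convert key using 1
  funext a b
  cases a <;> cases b <;> simp
end
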